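/- Let $(m_1(k))$, $(m_2(k))$ be sequences of nonnegative integers with $m_1(k) \to \infty$, $m_2(k) \le m_1(k)$, and $(m_1(k) - m_2(k))/\sqrt{m_1(k)} \to \rho$ for some constant $\rho > 0$. Then for every real $x$ with $0 < x < 1$: $\mathbb{P}\big(H_{m_1(k), m_2(k)} \le x\, m_1(k)\big) \to \int_0^x \sqrt{\tfrac{\rho^2/2}{2\pi}}\, (1-u)^{-3/2} u^{-1/2} e^{-\frac{(\rho^2/2)\,u}{2(1-u)}}\, du$ as $k \to \infty$; i.e., $H_{m_1,m_2}/m_1$ converges in distribution to $R(\rho^2/2)$, the reciprocal of a shifted Lévy random variable with parameter $c = \rho^2/2$. -/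

import Mathlib

/-- `h w` is the largest `k ≥ 0` such that the suffix of `w` of length `2k`
contains exactly `k` letters `a` (`true`) and `k` letters `b` (`false`):
half the number of cards remaining at the first pure luck guess in the
two-color card guessing game. -/
def h (w : List Bool) : ℕ :=
  (Finset.range (w.length + 1)).sup fun k =>
    if 2 * k ≤ w.length ∧ (w.drop (w.length - 2 * k)).count true = k then k else 0

/-- The words with `m₁` letters `a` and `m₂` letters `b`. -/
def wordsWith (m₁ m₂ : ℕ) : Finset (Fin (m₁ + m₂) → Bool) :=
  Finset.univ.filter fun w => (List.ofFn w).count true = m₁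

/-- `P(H_{m₁,m₂} ≤ t)`, for `H_{m₁,m₂} = h(W)` with `W` uniform on words with
`m₁` `a`'s and `m₂` `b`'s. -/
noncomputable def PHle (m₁ m₂ : ℕ) (t : ℝ) : ℝ :=
  (((wordsWith m₁ m₂).filter fun w => (h (List.ofFn w) : ℝ) ≤ t).card : ℝ) /
    ((m₁ + m₂).choose m₁ : ℝ)


theorem h_cons (c : Bool) (w : List Bool) (hw : 2 * (c :: w).count true ≠ w.length + 1) :
    h (c :: w) = h w := by
  unfold h
  rw [List.length_cons, Finset.range_add_one, Finset.sup_insert]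
  rw [if_neg (by omega)]
  simp only [zero_le, sup_of_le_right]
  apply Finset.sup_congr rfl
  intro k hk
  by_cases h1 : 2 * k ≤ w.length
  · have : w.length + 1 - 2 * k = (w.length - 2 * k) + 1 := by omega
    rw [this, List.drop_succ_cons]
    simp [h1, Nat.le_succ_of_le h1]
  · rw [if_neg (c := 2 * k ≤ w.length ∧ _) (by omega)]
    by_cases h2 : 2 * k = w.length + 1
    · rw [if_neg]
      rintro ⟨_, h3⟩
      rw [h2, Nat.sub_self, List.drop_zero] at h3
      omega
    · rw [if_neg (by omega)]

theorem h_spec (w : List Bool) :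
    2 * h w ≤ w.length ∧ (w.drop (w.length - 2 * h w)).count true = h w := by
  have := Finset.exists_mem_eq_sup (Finset.range (w.length + 1)) ⟨0, by simp⟩
    (fun k => if 2 * k ≤ w.length ∧ (w.drop (w.length - 2 * k)).count true = k then k else 0)
  obtain ⟨k, hk, he⟩ := this
  change h w = _ at he
  by_cases hc : 2 * k ≤ w.length ∧ (w.drop (w.length - 2 * k)).count true = k
  · rw [if_pos hc] at he
    rw [he]; exact hc
  · rw [if_neg hc] at he
    rw [he]; simp

theorem h_balanced (w : List Bool) (m : ℕ) (hl : w.length = 2 * m) (hc : w.count true = m) :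
    h w = m := by
  apply le_antisymm
  · have := (h_spec w).1; omega
  · unfold h
    refine le_trans (b := if 2 * m ≤ w.length ∧ (w.drop (w.length - 2 * m)).count true = m then m else 0) ?_ 
      (Finset.le_sup (f := fun k => if 2 * k ≤ w.length ∧ (w.drop (w.length - 2 * k)).count true = k then k else 0) (b := m) (by simp; omega))
    rw [if_pos]
    simp [hl, hc]

theorem h_le_false (w : List Bool) : h w + w.count true ≤ w.length := by
  obtain ⟨h1, h2⟩ := h_spec w
  have h3 : w.count true = (w.take (w.length - 2 * h w)).count true +
      (w.drop (w.length - 2 * h w)).count true := by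
    rw [← List.count_append, List.take_append_drop]
  have h4 : (w.take (w.length - 2 * h w)).count true ≤ (w.take (w.length - 2 * h w)).length :=
    List.count_le_length
  rw [List.length_take] at h4
  omega

def cnt (n j k : ℕ) : ℕ :=
  ((Finset.univ : Finset (Fin n → Bool)).filter fun w =>
    (List.ofFn w).count true = j ∧ h (List.ofFn w) = k).card

theorem cnt_split (n : ℕ) (P : List Bool → Prop) [DecidablePred P] :
    ((Finset.univ : Finset (Fin (n+1) → Bool)).filter fun w => P (List.ofFn w)).card =
    ((Finset.univ : Finset (Fin n → Bool)).filter fun w => P (true :: List.ofFn w)).card +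
    ((Finset.univ : Finset (Fin n → Bool)).filter fun w => P (false :: List.ofFn w)).card := by
  simp only [Finset.card_filter]
  rw [← (Fin.consEquiv (fun _ : Fin (n+1) => Bool)).sum_comp, Fintype.sum_prod_type]
  simp [Fin.consEquiv, List.ofFn_succ]

theorem cnt_succ (n j k : ℕ) (hb : 2 * (j + 1) ≠ n + 1) :
    cnt (n + 1) (j + 1) k = cnt n j k + cnt n (j + 1) k := by
  unfold cnt
  rw [cnt_split n (fun l => l.count true = j + 1 ∧ h l = k)]
  congr 2
  · ext w
    simp only [Finset.mem_filter, Finset.mem_univ, true_and]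
    constructor
    · rintro ⟨h1, h2⟩
      rw [h_cons _ _ (by rw [h1]; simpa using hb)] at h2
      simp at h1
      exact ⟨h1, h2⟩
    · rintro ⟨h1, h2⟩
      have h3 : (true :: List.ofFn w).count true = j + 1 := by simp [h1]
      rw [h_cons _ _ (by rw [h3]; simpa using hb)]
      exact ⟨h3, h2⟩
  · ext w
    simp only [Finset.mem_filter, Finset.mem_univ, true_and]
    constructor
    · rintro ⟨h1, h2⟩
      rw [h_cons _ _ (by rw [h1]; simpa using hb)] at h2
      simp at h1
      exact ⟨h1, h2⟩
    · rintro ⟨h1, h2⟩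
      have h3 : (false :: List.ofFn w).count true = j + 1 := by simp [h1]
      rw [h_cons _ _ (by rw [h3]; simpa using hb)]
      exact ⟨h3, h2⟩

theorem card_count (n : ℕ) : ∀ j : ℕ, ((Finset.univ : Finset (Fin n → Bool)).filter fun w =>
    (List.ofFn w).count true = j).card = n.choose j := by
  induction n with
  | zero => intro j; cases j <;> simp
  | succ n ih =>
    intro j
    rw [cnt_split n (fun l => l.count true = j)]
    cases j with
    | zero => simp [ih]
    | succ j => simp [ih, Nat.choose_succ_succ]

theorem cnt_diag (m : ℕ) : cnt (2 * m) m m = (2 * m).choose m := by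
  rw [← card_count]
  unfold cnt
  congr 1
  ext w
  simp only [Finset.mem_filter, Finset.mem_univ, true_and, and_iff_left_iff_imp]
  intro hc
  exact h_balanced _ m (by simp) hc

theorem cnt_diag_ne (m k : ℕ) (hk : k ≠ m) : cnt (2 * m) m k = 0 := by
  unfold cnt
  rw [Finset.card_eq_zero, Finset.filter_eq_empty_iff]
  rintro w - ⟨hc, hh⟩
  have := h_balanced _ m (by simp) hc
  omega

theorem cnt_zero (n j k : ℕ) (hk : n < k + j) : cnt n j k = 0 := by
  unfold cnt
  rw [Finset.card_eq_zero, Finset.filter_eq_empty_iff]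
  rintro w - ⟨hc, hh⟩
  have := h_le_false (List.ofFn w)
  rw [List.length_ofFn] at this
  rw [hc, hh] at this
  omega

theorem cnt_b0 (k d : ℕ) : cnt (2 * k + d) (k + d) k = (2 * k).choose k := by
  induction d with
  | zero => exact cnt_diag k
  | succ d ih =>
    have := cnt_succ (2 * k + d) (k + d) k (by omega)
    rw [ih, cnt_zero (2 * k + d) (k + d + 1) k (by omega)] at this
    exact this

theorem cnt_formula (k : ℕ) : ∀ n b d : ℕ, n = 2 * b + d →
    (2 * b + d : ℝ) * cnt (2 * k + 2 * b + d) (k + b + d) k =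
      d * (2 * b + d).choose (b + d) * (2 * k).choose k := by
  intro n
  induction n with
  | zero =>
    intro b d hn
    have : b = 0 := by omega
    have : d = 0 := by omega
    subst_vars; simp
  | succ n ih =>
    intro b d hn
    rcases Nat.eq_zero_or_pos b with rfl | hb
    · have := cnt_b0 k d
      simp only [mul_zero, add_zero, Nat.cast_zero, zero_add] at *
      rw [this]; simp
    rcases Nat.eq_zero_or_pos d with rfl | hd
    · have := cnt_diag_ne (k + b) k (by omega)
      rw [show 2 * k + 2 * b + 0 = 2 * (k + b) by ring, show k + b + 0 = k + b by ring, this]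
      simp
    obtain ⟨b, rfl⟩ : ∃ b', b = b' + 1 := ⟨b - 1, by omega⟩
    obtain ⟨d, rfl⟩ : ∃ d', d = d' + 1 := ⟨d - 1, by omega⟩
    have hs := cnt_succ (2 * k + 2 * (b + 1) + d) (k + (b + 1) + d) k (by omega)
    have i1 := ih (b + 1) d (by omega)
    have i2 := ih b (d + 2) (by omega)
    rw [show 2 * k + 2 * b + (d + 2) = 2 * k + 2 * (b + 1) + d by ring,
      show k + b + (d + 2) = k + (b + 1) + d + 1 by ring] at i2
    rw [show 2 * k + 2 * (b + 1) + (d + 1) = 2 * k + 2 * (b + 1) + d + 1 by ring,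
      show k + (b + 1) + (d + 1) = k + (b + 1) + d + 1 by ring, hs]
    rw [show 2 * b + (d + 2) = 2 * (b + 1) + d by ring] at i2
    have c1 := Nat.add_one_mul_choose_eq (2 * (b + 1) + d) (b + 1 + d)
    have c2 := Nat.choose_succ_succ (2 * (b + 1) + d) (b + 1 + d)
    rw [show 2 * (b + 1) + (d + 1) = 2 * (b + 1) + d + 1 by ring,
      show b + 1 + (d + 1) = b + 1 + d + 1 by ring]
    rw [show b + (d + 2) = b + 1 + d + 1 by ring] at i2
    simp only [Nat.succ_eq_add_one] at c2
    generalize (2 * (b + 1) + d + 1).choose (b + 1 + d + 1) = X at *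
    generalize (2 * (b + 1) + d).choose (b + 1 + d + 1) = Y at *
    generalize (2 * (b + 1) + d).choose (b + 1 + d) = Z at *
    generalize cnt _ _ _ = U at *
    generalize cnt _ _ _ = V at *
    generalize (2*k).choose k = W at *
    have c1' : ((2 * (b + 1) + d + 1 : ℕ) : ℝ) * Z = X * (b + 1 + d + 1 : ℕ) := by exact_mod_cast c1
    have c2' : (X : ℝ) = Z + Y := by exact_mod_cast c2
    push_cast at *
    have hn0 : (2 * ((b:ℝ) + 1) + d) ≠ 0 := by positivity
    apply mul_left_cancel₀ hn0
    have hY : (Y : ℝ) = X - Z := by linarith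
    rw [hY] at i2
    linear_combination (2 * (b + 1) + d + 1 : ℝ) * i1 + (2 * (b + 1) + d + 1 : ℝ) * i2 - 2 * W * c1'

theorem cnt_formula' (m₁ m₂ k : ℕ) (h1 : m₂ < m₁) (h2 : k ≤ m₂) :
    (cnt (m₁ + m₂) m₁ k : ℝ) = ((m₁:ℝ) - m₂) / (((m₁ - k) + (m₂ - k) : ℕ) : ℝ) *
      ((m₁ - k) + (m₂ - k)).choose (m₁ - k) * (k + k).choose k := by
  obtain ⟨b, rfl⟩ := Nat.exists_eq_add_of_le h2
  obtain ⟨d, rfl⟩ := Nat.exists_eq_add_of_le h1.le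
  have := cnt_formula k _ b d rfl
  rw [show k + b + d - k = b + d by omega, show k + b - k = b by omega,
    show b + d + b = 2 * b + d by ring, show k + b + d + (k + b) = 2 * k + 2 * b + d by ring,
    show k + k = 2 * k by ring]
  have hd : 0 < d := by omega
  have : (2 * (b:ℝ) + d) ≠ 0 := by positivity
  push_cast
  field_simp
  linarith

theorem PHle_eq (m₁ m₂ : ℕ) (t : ℝ) (ht : 0 ≤ t) :
    PHle m₁ m₂ t = ∑ k ∈ Finset.range (⌊t⌋₊ + 1),
      (cnt (m₁ + m₂) m₁ k : ℝ) / ((m₁ + m₂).choose m₁ : ℝ) := by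
  unfold PHle
  rw [← Finset.sum_div, ← Nat.cast_sum]
  congr 2
  rw [Finset.card_eq_sum_card_fiberwise (f := fun w => h (List.ofFn w)) (t := Finset.range (⌊t⌋₊ + 1))]
  · apply Finset.sum_congr rfl
    intro k hk
    unfold cnt wordsWith
    congr 1
    ext w
    simp only [Finset.mem_filter, Finset.mem_univ, true_and]
    constructor
    · rintro ⟨⟨h1, h2⟩, h3⟩; exact ⟨h1, h3⟩
    · rintro ⟨h1, h3⟩
      refine ⟨⟨h1, ?_⟩, h3⟩
      rw [h3]
      rw [Finset.mem_range] at hk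
      exact (Nat.le_floor_iff ht).1 (by omega)
  · intro w hw
    simp only [Finset.coe_filter, Set.mem_ofPred_eq] at hw
    have := (Nat.le_floor_iff ht).2 hw.2
    simp; omega

open Filter Topology

theorem choose_bound_even (k : ℕ) : (Nat.centralBinom k) ^ 2 * (k + 1) ≤ 16 ^ k := by
  induction k with
  | zero => simp
  | succ k ih =>
    have h1 := Nat.succ_mul_centralBinom_succ k
    have h2 : 0 < (k + 1) ^ 2 := by positivity
    apply Nat.le_of_mul_le_mul_left _ h2
    calc (k + 1) ^ 2 * ((k + 1).centralBinom ^ 2 * (k + 1 + 1))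
        = ((k + 1) * (k + 1).centralBinom) ^ 2 * (k + 2) := by ring
      _ = 4 * ((2 * k + 1) ^ 2 * (k + 2)) * k.centralBinom ^ 2 := by rw [h1]; ring
      _ ≤ 4 * (4 * (k + 1) ^ 2 * (k + 1)) * k.centralBinom ^ 2 := by
          gcongr 4 * ?_ * _
          nlinarith
      _ = 16 * (k + 1) ^ 2 * (k.centralBinom ^ 2 * (k + 1)) := by ring
      _ ≤ 16 * (k + 1) ^ 2 * 16 ^ k := by gcongr
      _ = _ := by ring

theorem choose_bound (n a : ℕ) : (n.choose a) ^ 2 * (n + 1) ≤ 2 * 4 ^ n := by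
  have e1 (k a : ℕ) : (2 * k).choose a ≤ k.centralBinom := Nat.choose_le_centralBinom a k
  rcases Nat.even_or_odd' n with ⟨k, rfl | rfl⟩
  · have := choose_bound_even k
    calc _ ≤ k.centralBinom ^ 2 * (2 * (k + 1)) := by
          gcongr
          · exact e1 k a
          · omega
      _ = 2 * (k.centralBinom ^ 2 * (k + 1)) := by ring
      _ ≤ 2 * 16 ^ k := by gcongr
      _ = _ := by rw [pow_mul]; norm_num
  · have := choose_bound_even k
    have h2 : (2 * k + 1).choose a ≤ 2 * k.centralBinom := by
      cases a with
      | zero => have := Nat.centralBinom_pos k; simp; omega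
      | succ a =>
        rw [Nat.choose_succ_succ]
        have := e1 k a
        have := e1 k (a + 1)
        simp only [Nat.succ_eq_add_one]
        omega
    calc _ ≤ (2 * k.centralBinom) ^ 2 * (2 * (k + 1)) := by
          gcongr
          omega
      _ = 8 * (k.centralBinom ^ 2 * (k + 1)) := by ring
      _ ≤ 8 * 16 ^ k := by gcongr
      _ = _ := by rw [pow_add, pow_mul]; norm_num; ring

theorem choose_bound_real (n a : ℕ) :
    (n.choose a : ℝ) ≤ √2 * 2 ^ n / √((n:ℝ) + 1) := by
  have h := choose_bound n a
  have h' : (n.choose a : ℝ) ^ 2 * ((n:ℝ) + 1) ≤ 2 * 4 ^ n := by exact_mod_cast h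
  rw [le_div_iff₀ (by positivity)]
  apply abs_le_of_sq_le_sq' _ (by positivity) |>.2
  rw [mul_pow, mul_pow, Real.sq_sqrt (by positivity), Real.sq_sqrt (by positivity), ← pow_mul,
    mul_comm n 2, pow_mul]
  norm_num
  exact h'

theorem log_rem (t : ℝ) (ht : |t| ≤ 1/2) :
    |Real.log (1 - t) + t + t ^ 2 / 2| ≤ 2 * |t| ^ 3 := by
  have := Real.abs_log_sub_add_sum_range_le (x := t) (by linarith) 2
  simp [Finset.sum_range_succ] at this
  calc _ = |t + t ^ 2 / (1 + 1) + Real.log (1 - t)| := by congr 1; ring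
    _ ≤ _ := this
    _ ≤ |t| ^ 3 / (1/2) := by gcongr; linarith
    _ = _ := by ring

noncomputable def stir (n : ℕ) : ℝ := n.factorial / (√(2 * n * Real.pi) * (n / Real.exp 1) ^ n)

theorem stir_tendsto : Tendsto stir atTop (𝓝 1) := by
  have := Stirling.factorial_isEquivalent_stirling
  rw [Asymptotics.isEquivalent_iff_tendsto_one] at this
  · exact this
  · filter_upwards [eventually_gt_atTop 0] with n hn
    have : (0:ℝ) < n := by exact_mod_cast hn
    have := Real.pi_pos
    positivity

theorem stir_eq (n : ℕ) (hn : 0 < n) :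
    (n.factorial : ℝ) = stir n * √(2 * Real.pi) * √n * n ^ n / Real.exp 1 ^ n := by
  unfold stir
  have : (0:ℝ) < n := by exact_mod_cast hn
  have := Real.pi_pos
  rw [show 2 * (n:ℝ) * Real.pi = 2 * Real.pi * n by ring, Real.sqrt_mul (by positivity), div_pow]
  field_simp

theorem binom_eq (a b : ℕ) (ha : 0 < a) (hb : 0 < b) :
    √((a + b : ℕ) : ℝ) * ((a + b).choose a : ℝ) / 2 ^ (a + b) =
    stir (a + b) / (stir a * stir b) * 
     (√(2 / Real.pi) / √((1 + ((a:ℝ) - b) / (a + b)) * (1 - ((a:ℝ) - b) / (a + b)))) *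
     Real.exp (-(a * Real.log (1 + ((a:ℝ) - b) / (a + b)) +
        b * Real.log (1 - ((a:ℝ) - b) / (a + b)))) := by
  have ha' : (0:ℝ) < a := by exact_mod_cast ha
  have hb' : (0:ℝ) < b := by exact_mod_cast hb
  have hpi := Real.pi_pos
  rw [show 1 + ((a:ℝ) - b) / (a + b) = 2 * a / (a + b) by field_simp; ring,
    show 1 - ((a:ℝ) - b) / (a + b) = 2 * b / (a + b) by field_simp; ring]
  have e1 : Real.exp (-(a * Real.log (2 * a / (a + b)) + b * Real.log (2 * b / ((a:ℝ) + b)))) =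
      ((2 * a / (a + b)) ^ a * (2 * b / ((a:ℝ) + b)) ^ b)⁻¹ := by
    rw [Real.exp_neg, Real.exp_add, ← Real.log_pow, ← Real.log_pow, Real.exp_log (by positivity),
      Real.exp_log (by positivity)]
  rw [e1, Nat.choose_symm_add, Nat.add_choose, Nat.cast_div (Nat.factorial_mul_factorial_dvd_factorial_add a b)
    (by positivity), Nat.cast_mul]
  rw [stir_eq a ha, stir_eq b hb, stir_eq (a + b) (by omega)]
  have sa : stir a ≠ 0 := by unfold stir; positivity
  have sb : stir b ≠ 0 := by unfold stir; positivity
  rw [show 2 * (a:ℝ) / (a + b) * (2 * b / (a + b)) = (2 / (a + b)) ^ 2 * (a * b) by field_simp,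
    Real.sqrt_mul (by positivity) (a * b : ℝ), Real.sqrt_sq (by positivity), Real.sqrt_mul ha'.le,
    Real.sqrt_div (by norm_num), Real.sqrt_mul (by norm_num) Real.pi]
  push_cast
  simp only [div_pow, mul_pow, pow_add]
  have h2 : √(2:ℝ) ^ 2 = 2 := Real.sq_sqrt (by norm_num)
  have hab : √((a:ℝ) + b) ^ 2 = a + b := Real.sq_sqrt (by positivity)
  have hpi2 : √Real.pi ≠ 0 := by positivity
  have : √(a:ℝ) ≠ 0 := by positivity
  have : √(b:ℝ) ≠ 0 := by positivity
  field_simp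
  rw [h2, hab]

theorem lclt {ι : Type*} {l : Filter ι} (a b : ι → ℕ) (σ : ℝ)
    (hn : Tendsto (fun i => ((a i + b i : ℕ) : ℝ)) l atTop)
    (hs : Tendsto (fun i => ((a i : ℝ) - b i) / √((a i + b i : ℕ) : ℝ)) l (𝓝 σ)) :
    Tendsto (fun i => √((a i + b i : ℕ) : ℝ) * ((a i + b i).choose (a i) : ℝ) / 2 ^ (a i + b i)) l
      (𝓝 (√(2 / Real.pi) * Real.exp (-(σ ^ 2 / 2)))) := by
  set t : ι → ℝ := fun i => ((a i : ℝ) - b i) / (a i + b i) with htdef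
  have hsq : Tendsto (fun i => √((a i + b i : ℕ) : ℝ)) l atTop :=
    Real.tendsto_sqrt_atTop.comp hn
  have ht : Tendsto t l (𝓝 0) := by
    have := hs.div_atTop hsq
    refine this.congr fun i => ?_
    rw [div_div, Real.mul_self_sqrt (by positivity)]
    simp [t]
  have hnpos : ∀ᶠ i in l, (0:ℝ) < ((a i + b i : ℕ) : ℝ) := hn.eventually_gt_atTop 0
  have hapos' : Tendsto (fun i => (a i : ℝ)) l atTop := by
    have h1 : Tendsto (fun i => (1 + t i) / 2) l (𝓝 ((1 + 0) / 2)) := (ht.const_add 1).div_const 2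
    refine (hn.atTop_mul_pos (by norm_num) h1).congr' ?_
    filter_upwards [hnpos] with i hi
    push_cast at hi ⊢
    simp only [t]; field_simp; ring
  have hbpos' : Tendsto (fun i => (b i : ℝ)) l atTop := by
    have h1 : Tendsto (fun i => (1 - t i) / 2) l (𝓝 ((1 - 0) / 2)) := (ht.const_sub 1).div_const 2
    refine (hn.atTop_mul_pos (by norm_num) h1).congr' ?_
    filter_upwards [hnpos] with i hi
    push_cast at hi ⊢
    simp only [t]; field_simp; ring
  have ha : Tendsto a l atTop := tendsto_natCast_atTop_iff.1 hapos'
  have hb : Tendsto b l atTop := tendsto_natCast_atTop_iff.1 hbpos'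
  have hab : Tendsto (fun i => a i + b i) l atTop := tendsto_natCast_atTop_iff.1 hn
  have hnt : Tendsto (fun i => ((a i + b i : ℕ) : ℝ) * t i ^ 2) l (𝓝 (σ ^ 2)) := by
    refine (hs.pow 2).congr' ?_
    filter_upwards [hnpos] with i hi
    rw [div_pow, Real.sq_sqrt hi.le]
    push_cast at hi ⊢
    simp only [t]; field_simp
  have hrem : Tendsto (fun i => (a i * Real.log (1 + t i) + b i * Real.log (1 - t i)) -
      ((a i + b i : ℕ) : ℝ) * t i ^ 2 / 2) l (𝓝 0) := by
    have hb0 : Tendsto (fun i => 2 * (((a i + b i : ℕ) : ℝ) * t i ^ 2) * |t i|) l (𝓝 0) := by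
      have := (hnt.const_mul 2).mul ht.abs
      simpa using this
    refine squeeze_zero_norm' ?_ hb0
    have hsmall : ∀ᶠ i in l, |t i| < 1/2 := by
      have := ht.abs
      rw [abs_zero] at this
      exact this.eventually_lt_const (by norm_num)
    filter_upwards [hsmall, hnpos] with i hi hni
    have r1 := log_rem (t i) hi.le
    have r2 := log_rem (-t i) (by rw [abs_neg]; exact hi.le)
    rw [abs_neg, sub_neg_eq_add, neg_sq] at r2
    have hdiff : (a i : ℝ) - b i = ((a i + b i : ℕ) : ℝ) * t i := by
      push_cast at hni ⊢
      simp only [t]; field_simp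
    push_cast at hdiff ⊢
    rw [Real.norm_eq_abs]
    calc _ = |a i * (Real.log (1 + t i) + -t i + t i ^ 2 / 2) +
          b i * (Real.log (1 - t i) + t i + t i ^ 2 / 2)| := by
            congr 1
            linear_combination (t i) * hdiff
      _ ≤ a i * (2 * |t i| ^ 3) + b i * (2 * |t i| ^ 3) := by
          refine (abs_add_le _ _).trans ?_
          rw [abs_mul, abs_mul, Nat.abs_cast, Nat.abs_cast]
          gcongr
      _ = 2 * (((a i : ℝ) + b i) * |t i| ^ 2) * |t i| := by ring
      _ = _ := by rw [sq_abs]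
  have hexp : Tendsto (fun i => Real.exp (-(a i * Real.log (1 + t i) + b i * Real.log (1 - t i)))) l
      (𝓝 (Real.exp (-(σ ^ 2 / 2)))) := by
    have := (hrem.add (hnt.div_const 2)).neg
    rw [zero_add] at this
    refine ((Real.continuous_exp.tendsto _).comp this).congr fun i => ?_
    simp
  have hst : Tendsto (fun i => stir (a i + b i) / (stir (a i) * stir (b i))) l (𝓝 1) := by
    have := (stir_tendsto.comp hab).div ((stir_tendsto.comp ha).mul (stir_tendsto.comp hb)) (by norm_num)
    rw [one_mul, div_one] at this
    exact this
  have hq : Tendsto (fun i => √(2 / Real.pi) / √((1 + t i) * (1 - t i))) l (𝓝 (√(2 / Real.pi))) := by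
    have h1 : Tendsto (fun i => √((1 + t i) * (1 - t i))) l (𝓝 (√((1 + 0) * (1 - 0)))) :=
      ((ht.const_add 1).mul (ht.const_sub 1)).sqrt
    have := (tendsto_const_nhds (x := √(2 / Real.pi))).div h1 (by norm_num)
    simp only [add_zero, sub_zero, mul_one, Real.sqrt_one, div_one] at this
    exact this
  have := (hst.mul hq).mul hexp
  rw [one_mul] at this
  refine this.congr' ?_
  filter_upwards [ha.eventually_gt_atTop 0, hb.eventually_gt_atTop 0] with i h1 h2
  exact (binom_eq (a i) (b i) h1 h2).symm

noncomputable def pr (m₁ m₂ k : ℕ) : ℝ :=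
  (cnt (m₁ + m₂) m₁ k : ℝ) / ((m₁ + m₂).choose m₁ : ℝ)

theorem floor_piece_int (q : ℕ → ℝ) (k : ℕ) :
    IntervalIntegrable (fun v : ℝ => q ⌊v⌋₊) MeasureTheory.volume (k : ℝ) ((k + 1 : ℕ) : ℝ) ∧
    ∫ v in (k : ℝ)..((k + 1 : ℕ) : ℝ), q ⌊v⌋₊ = q k := by
  have hle : (k : ℝ) ≤ ((k + 1 : ℕ) : ℝ) := by push_cast; linarith
  have he : Set.EqOn (fun v : ℝ => q ⌊v⌋₊) (fun _ => q k) (Set.Ioo (k : ℝ) ((k + 1 : ℕ) : ℝ)) := by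
    intro v hv
    have : ⌊v⌋₊ = k := by
      rw [Nat.floor_eq_iff (by have := hv.1; have : (0:ℝ) ≤ k := by positivity
                               linarith)]
      exact ⟨hv.1.le, by have := hv.2; push_cast at this; exact this⟩
    simp [this]
  constructor
  · rw [intervalIntegrable_iff_integrableOn_Ioo_of_le hle]
    exact (MeasureTheory.integrableOn_const (by simp)).congr_fun he.symm measurableSet_Ioo
  · rw [intervalIntegral.integral_of_le hle, MeasureTheory.integral_Ioc_eq_integral_Ioo,
      MeasureTheory.setIntegral_congr_fun measurableSet_Ioo he]
    simp

theorem floor_int (q : ℕ → ℝ) (K : ℕ) :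
    IntervalIntegrable (fun v : ℝ => q ⌊v⌋₊) MeasureTheory.volume (0 : ℝ) (K : ℝ) ∧
    ∫ v in (0 : ℝ)..(K : ℝ), q ⌊v⌋₊ = ∑ k ∈ Finset.range K, q k := by
  have h1 := intervalIntegral.sum_integral_adjacent_intervals (n := K)
    (f := fun v : ℝ => q ⌊v⌋₊) (a := fun k : ℕ => (k : ℝ)) (μ := MeasureTheory.volume)
    (fun k _ => (floor_piece_int q k).1)
  have h2 := IntervalIntegrable.trans_iterate (n := K)
    (f := fun v : ℝ => q ⌊v⌋₊) (a := fun k : ℕ => (k : ℝ)) (μ := MeasureTheory.volume)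
    (fun k _ => (floor_piece_int q k).1)
  simp only [Nat.cast_zero] at h1 h2
  refine ⟨h2, ?_⟩
  rw [← h1]
  exact Finset.sum_congr rfl fun k _ => (floor_piece_int q k).2

theorem floor_scaled (q : ℕ → ℝ) (m : ℝ) (hm : 0 < m) (K : ℕ) :
    IntervalIntegrable (fun u : ℝ => m * q ⌊u * m⌋₊) MeasureTheory.volume (0 : ℝ) ((K : ℝ) / m) ∧
    ∫ u in (0 : ℝ)..((K : ℝ) / m), m * q ⌊u * m⌋₊ = ∑ k ∈ Finset.range K, q k := by
  obtain ⟨h1, h2⟩ := floor_int q K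
  constructor
  · have := (h1.comp_mul_right (c := m)).const_mul m
    simpa using this
  · rw [intervalIntegral.integral_const_mul,
      intervalIntegral.integral_comp_mul_right (fun v => q ⌊v⌋₊) hm.ne', zero_mul,
      div_mul_cancel₀ _ hm.ne', h2, smul_eq_mul, mul_inv_cancel_left₀ hm.ne']

noncomputable def gg (a b : ℕ) : ℝ :=
  √((a + b : ℕ) : ℝ) * ((a + b).choose a : ℝ) / 2 ^ (a + b)

theorem choose_eq_gg (a b : ℕ) (hab : 0 < a + b) :
    ((a + b).choose a : ℝ) = gg a b * 2 ^ (a + b) / √((a + b : ℕ) : ℝ) := by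
  unfold gg
  have : (0:ℝ) < ((a + b : ℕ) : ℝ) := by exact_mod_cast hab
  have : 0 < √((a + b : ℕ) : ℝ) := by positivity
  field_simp

theorem gg_pos (a b : ℕ) (hab : 0 < a + b) : 0 < gg a b := by
  unfold gg
  have : (0:ℝ) < ((a + b : ℕ) : ℝ) := by exact_mod_cast hab
  have : 0 < (a + b).choose a := Nat.choose_pos (by omega)
  positivity

theorem pr_eq (m₁ m₂ k : ℕ) (h1 : m₂ < m₁) (h2 : k ≤ m₂) (hk : 0 < k) :
    (m₁ : ℝ) * pr m₁ m₂ k = (((m₁ : ℝ) - m₂) / √(m₁ : ℝ)) *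
      ((((m₁ - k) + (m₂ - k) : ℕ) : ℝ) / m₁)⁻¹ * (√((((m₁ - k) + (m₂ - k) : ℕ) : ℝ) / m₁))⁻¹ *
      (√(((k + k : ℕ) : ℝ) / m₁))⁻¹ * √(((m₁ + m₂ : ℕ) : ℝ) / m₁) *
      (gg (m₁ - k) (m₂ - k) * gg k k / gg m₁ m₂) := by
  unfold pr
  rw [cnt_formula' m₁ m₂ k h1 h2, choose_eq_gg (m₁ - k) (m₂ - k) (by omega),
    choose_eq_gg k k (by omega), choose_eq_gg m₁ m₂ (by omega)]
  have hp : (2:ℝ) ^ (m₁ + m₂) = 2 ^ (m₁ - k + (m₂ - k)) * 2 ^ (k + k) := by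
    rw [← pow_add]; congr 1; omega
  rw [hp]
  have g0 := gg_pos m₁ m₂ (by omega)
  have a1 : (0:ℝ) < m₁ := by exact_mod_cast (by omega)
  have a2 : (0:ℝ) < ((m₁ - k + (m₂ - k) : ℕ) : ℝ) := by exact_mod_cast (by omega)
  have a3 : (0:ℝ) < ((k + k : ℕ) : ℝ) := by exact_mod_cast (by omega)
  have a4 : (0:ℝ) < ((m₁ + m₂ : ℕ) : ℝ) := by exact_mod_cast (by omega)
  rw [Real.sqrt_div a2.le, Real.sqrt_div a3.le, Real.sqrt_div a4.le]
  have b1 := Real.sqrt_pos.2 a1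
  have b2 := Real.sqrt_pos.2 a2
  have b3 := Real.sqrt_pos.2 a3
  have b4 := Real.sqrt_pos.2 a4
  generalize gg (m₁ - k) (m₂ - k) = X1 at *
  generalize gg k k = X2 at *
  generalize gg m₁ m₂ = X3 at *
  generalize ((m₁ - k + (m₂ - k) : ℕ) : ℝ) = Y1 at *
  generalize ((m₁ + m₂ : ℕ) : ℝ) = Y2 at *
  generalize ((k + k : ℕ) : ℝ) = Y3 at *
  have z1 : (2:ℝ) ^ (m₁ - k + (m₂ - k)) ≠ 0 := by positivity
  generalize (2:ℝ) ^ (m₁ - k + (m₂ - k)) = Z1 at *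
  field_simp

theorem limit_eq (ρ u : ℝ) (hρ : 0 < ρ) (hu : 0 < u) (hu1 : u < 1) :
    ρ * (2 * (1 - u))⁻¹ * (√(2 * (1 - u)))⁻¹ * (√(2 * u))⁻¹ * √2 *
      ((√(2 / Real.pi) * Real.exp (-((ρ / √(2 * (1 - u))) ^ 2 / 2))) *
       (√(2 / Real.pi) * Real.exp (-((0:ℝ) ^ 2 / 2))) /
       (√(2 / Real.pi) * Real.exp (-((ρ / √2) ^ 2 / 2)))) =
    Real.sqrt ((ρ ^ 2 / 2) / (2 * Real.pi)) * (1 - u) ^ (-(3:ℝ)/2) *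
            u ^ (-(1:ℝ)/2) * Real.exp (-((ρ ^ 2 / 2) * u) / (2 * (1 - u))) := by
  have h1 : 0 < 1 - u := by linarith
  have hpi := Real.pi_pos
  have hexp : Real.exp (-((ρ ^ 2 / 2) * u) / (2 * (1 - u))) =
      Real.exp (-((ρ / √(2 * (1 - u))) ^ 2 / 2)) / Real.exp (-((ρ / √2) ^ 2 / 2)) := by
    rw [← Real.exp_sub]
    congr 1
    rw [div_pow, div_pow, Real.sq_sqrt (by positivity), Real.sq_sqrt (by positivity)]
    field_simp
    ring
  have e1 : (1 - u) ^ (-(3:ℝ)/2) = (1 - u)⁻¹ * (√(1 - u))⁻¹ := by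
    rw [Real.sqrt_eq_rpow, ← Real.rpow_neg h1.le, ← Real.rpow_neg_one, ← Real.rpow_add h1]
    norm_num
  have e2 : u ^ (-(1:ℝ)/2) = (√u)⁻¹ := by
    rw [Real.sqrt_eq_rpow, ← Real.rpow_neg hu.le]
    norm_num
  have e3 : √((ρ ^ 2 / 2) / (2 * Real.pi)) = ρ / (2 * √Real.pi) := by
    rw [show (ρ ^ 2 / 2) / (2 * Real.pi) = (ρ / 2) ^ 2 / Real.pi by field_simp,
      Real.sqrt_div (by positivity), Real.sqrt_sq (by positivity)]
    field_simp
  rw [hexp, e1, e2, e3, Real.sqrt_mul (by norm_num), Real.sqrt_mul (by norm_num),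
    Real.sqrt_div (by norm_num)]
  have h2 : √(2:ℝ) ^ 2 = 2 := Real.sq_sqrt (by norm_num)
  have := Real.sqrt_pos.2 hpi
  have := Real.sqrt_pos.2 hu
  have := Real.sqrt_pos.2 h1
  simp only [ne_eq, OfNat.ofNat_ne_zero, not_false_eq_true, zero_pow, zero_div, neg_zero, Real.exp_zero]
  field_simp
  try rw [h2]
  try ring

theorem ratio_lim (m₁ m₂ : ℕ → ℕ) (ρ : ℝ)
    (hm : Tendsto (fun k => (m₁ k : ℝ)) atTop atTop)
    (hρlim : Tendsto (fun k => ((m₁ k : ℝ) - (m₂ k : ℝ)) / Real.sqrt (m₁ k)) atTop (𝓝 ρ)) : Tendsto (fun j => (m₂ j : ℝ) / m₁ j) atTop (𝓝 1) := by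
  have h1 := hρlim.div_atTop (Real.tendsto_sqrt_atTop.comp hm)
  have h2 := h1.const_sub 1
  rw [sub_zero] at h2
  refine h2.congr' ?_
  filter_upwards [hm.eventually_gt_atTop 0] with j hj
  simp only [Function.comp]
  rw [div_div, Real.mul_self_sqrt hj.le]
  field_simp
  ring

theorem ev_lt (m₁ m₂ : ℕ → ℕ) (ρ : ℝ) (hρ : 0 < ρ)
    (hρlim : Tendsto (fun k => ((m₁ k : ℝ) - (m₂ k : ℝ)) / Real.sqrt (m₁ k)) atTop (𝓝 ρ)) : ∀ᶠ j in atTop, m₂ j < m₁ j := by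
  filter_upwards [hρlim.eventually_const_lt hρ] with j hj
  by_contra hc
  have : (m₁ j : ℝ) ≤ m₂ j := by exact_mod_cast (not_lt.1 hc)
  have := div_nonpos_of_nonpos_of_nonneg (sub_nonpos.2 this) (Real.sqrt_nonneg (m₁ j : ℝ))
  linarith

theorem gg3_lim (m₁ m₂ : ℕ → ℕ) (ρ : ℝ)
    (hm : Tendsto (fun k => (m₁ k : ℝ)) atTop atTop)
    (hρlim : Tendsto (fun k => ((m₁ k : ℝ) - (m₂ k : ℝ)) / Real.sqrt (m₁ k)) atTop (𝓝 ρ)) : Tendsto (fun j => gg (m₁ j) (m₂ j)) atTop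
    (𝓝 (√(2 / Real.pi) * Real.exp (-((ρ / √2) ^ 2 / 2)))) := by
  have hN : Tendsto (fun j => ((m₁ j + m₂ j : ℕ) : ℝ)) atTop atTop :=
    tendsto_atTop_mono (fun j => by push_cast; linarith [(m₂ j).cast_nonneg (α := ℝ)]) hm
  refine lclt m₁ m₂ _ hN ?_
  have h1 := ((ratio_lim m₁ m₂ ρ hm hρlim).const_add 1).sqrt
  rw [one_add_one_eq_two] at h1
  refine (hρlim.div h1 (by positivity)).congr' ?_
  filter_upwards [hm.eventually_gt_atTop 0] with j hj
  simp only [Pi.div_apply]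
  rw [div_div, ← Real.sqrt_mul hj.le]
  congr 2
  push_cast
  field_simp

theorem ptw (m₁ m₂ : ℕ → ℕ) (ρ : ℝ) (hρ : 0 < ρ)
    (hm : Tendsto (fun k => (m₁ k : ℝ)) atTop atTop)
    (hρlim : Tendsto (fun k => ((m₁ k : ℝ) - (m₂ k : ℝ)) / Real.sqrt (m₁ k)) atTop (𝓝 ρ)) (u : ℝ) (hu : 0 < u) (hu1 : u < 1) :
    Tendsto (fun j => (m₁ j : ℝ) * pr (m₁ j) (m₂ j) ⌊u * m₁ j⌋₊) atTop
      (𝓝 (Real.sqrt ((ρ ^ 2 / 2) / (2 * Real.pi)) * (1 - u) ^ (-(3:ℝ)/2) *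
            u ^ (-(1:ℝ)/2) * Real.exp (-((ρ ^ 2 / 2) * u) / (2 * (1 - u))))) := by
  rw [← limit_eq ρ u hρ hu hu1]
  set k : ℕ → ℕ := fun j => ⌊u * m₁ j⌋₊ with hkdef
  have h1u : 0 < 1 - u := by linarith
  have hk : Tendsto (fun j => (k j : ℝ) / m₁ j) atTop (𝓝 u) :=
    (tendsto_nat_floor_mul_div_atTop hu.le).comp hm
  have hr := ratio_lim m₁ m₂ ρ hm hρlim
  have hpos := hm.eventually_gt_atTop 0
  have hkm : ∀ᶠ j in atTop, k j ≤ m₂ j := by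
    filter_upwards [hk.eventually_lt hr hu1, hpos] with j h1 h2
    have := (div_lt_div_iff_of_pos_right h2).1 h1
    exact_mod_cast this.le
  have hlt := ev_lt m₁ m₂ ρ hρ hρlim
  have hkpos : Tendsto (fun j => (k j : ℝ)) atTop atTop := by
    refine (hm.atTop_mul_pos hu hk).congr' ?_
    filter_upwards [hpos] with j hj
    field_simp
  have hn : Tendsto (fun j => ((m₁ j - k j + (m₂ j - k j) : ℕ) : ℝ) / m₁ j) atTop
      (𝓝 (2 * (1 - u))) := by
    have := (hr.const_add 1).sub (hk.const_mul 2)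
    rw [show 1 + 1 - 2 * u = 2 * (1 - u) by ring] at this
    refine this.congr' ?_
    filter_upwards [hkm, hlt, hpos] with j h1 h2 h3
    push_cast [Nat.cast_sub h1, Nat.cast_sub (h1.trans h2.le)]
    field_simp
    ring
  have hn' : Tendsto (fun j => ((m₁ j - k j + (m₂ j - k j) : ℕ) : ℝ)) atTop atTop := by
    refine (hm.atTop_mul_pos (by positivity) hn).congr' ?_
    filter_upwards [hpos] with j hj
    field_simp
  have g1 : Tendsto (fun j => gg (m₁ j - k j) (m₂ j - k j)) atTop
      (𝓝 (√(2 / Real.pi) * Real.exp (-((ρ / √(2 * (1 - u))) ^ 2 / 2)))) := by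
    refine lclt _ _ _ hn' ?_
    refine (hρlim.div hn.sqrt (by positivity)).congr' ?_
    filter_upwards [hkm, hlt, hpos] with j h1 h2 h3
    simp only [Pi.div_apply]
    rw [div_div, ← Real.sqrt_mul h3.le, mul_div_cancel₀ _ h3.ne']
    congr 1
    push_cast [Nat.cast_sub h1, Nat.cast_sub (h1.trans h2.le)]
    ring
  have hkk : Tendsto (fun j => ((k j + k j : ℕ) : ℝ) / m₁ j) atTop (𝓝 (2 * u)) := by
    refine (hk.const_mul 2).congr fun j => ?_
    push_cast; ring
  have g2 : Tendsto (fun j => gg (k j) (k j)) atTop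
      (𝓝 (√(2 / Real.pi) * Real.exp (-((0:ℝ) ^ 2 / 2)))) := by
    refine lclt k k 0 ?_ ?_
    · push_cast; exact hkpos.atTop_add_atTop hkpos
    · simp
  have g3 := gg3_lim m₁ m₂ ρ hm hρlim
  have hN : Tendsto (fun j => ((m₁ j + m₂ j : ℕ) : ℝ) / m₁ j) atTop (𝓝 2) := by
    have := hr.const_add 1
    rw [one_add_one_eq_two] at this
    refine this.congr' ?_
    filter_upwards [hpos] with j hj
    push_cast; field_simp
  have key := ((((hρlim.mul (hn.inv₀ (by positivity))).mul (hn.sqrt.inv₀ (by positivity))).mul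
    (hkk.sqrt.inv₀ (by positivity))).mul hN.sqrt).mul
    ((g1.mul g2).div g3 (by have := Real.pi_pos; positivity))
  refine key.congr' ?_
  filter_upwards [hkm, hlt, hkpos.eventually_gt_atTop 0] with j h1 h2 h3
  exact (pr_eq (m₁ j) (m₂ j) (k j) h2 h1 (by exact_mod_cast h3)).symm

theorem dom (m₁ m₂ : ℕ → ℕ) (ρ : ℝ) (hρ : 0 < ρ)
    (hm : Tendsto (fun k => (m₁ k : ℝ)) atTop atTop)
    (hρlim : Tendsto (fun k => ((m₁ k : ℝ) - (m₂ k : ℝ)) / Real.sqrt (m₁ k)) atTop (𝓝 ρ)) (y : ℝ) (hy : 0 < y) (hy1 : y < 1) : ∃ C : ℝ, 0 ≤ C ∧ ∀ᶠ j in atTop, ∀ u : ℝ, 0 < u → u ≤ y →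
    ‖(m₁ j : ℝ) * pr (m₁ j) (m₂ j) ⌊u * m₁ j⌋₊‖ ≤ C * (√u)⁻¹ := by
  have hpi := Real.pi_pos
  obtain ⟨c, hc, hc'⟩ : ∃ c, 0 < c ∧ c < √(2 / Real.pi) * Real.exp (-((ρ / √2) ^ 2 / 2)) :=
    exists_between (by positivity)
  have h1y : 0 < 1 - y := by linarith
  refine ⟨(ρ + 1) / (1 - y) * √2 / √(1 - y) * √2 * √2 / c, by positivity, ?_⟩
  filter_upwards [(gg3_lim m₁ m₂ ρ hm hρlim).eventually_const_lt hc', hm.eventually_gt_atTop 0,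
    ev_lt m₁ m₂ ρ hρ hρlim, hρlim.eventually_lt_const (show ρ < ρ + 1 by linarith),
    (ratio_lim m₁ m₂ ρ hm hρlim).eventually_const_lt hy1] with j hg hpos hlt hd hr u hu huy
  have hk1 : ((⌊u * m₁ j⌋₊ : ℕ) : ℝ) ≤ u * m₁ j := Nat.floor_le (by positivity)
  have hk2 : u * m₁ j < (⌊u * m₁ j⌋₊ : ℕ) + 1 := Nat.lt_floor_add_one _
  generalize ⌊u * (m₁ j : ℝ)⌋₊ = k at *
  generalize m₁ j = a at *
  generalize m₂ j = b at *
  rw [lt_div_iff₀ hpos] at hr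
  have hua : u * a ≤ y * a := by gcongr
  have hkb : k ≤ b := by
    have : (k : ℝ) ≤ b := by linarith
    exact_mod_cast this
  have hab : (b : ℝ) < a := by exact_mod_cast hlt
  have hpr : pr a b k = ((a : ℝ) - b) / (((a - k) + (b - k) : ℕ) : ℝ) *
      ((a - k) + (b - k)).choose (a - k) * (k + k).choose k / (a + b).choose a := by
    unfold pr; rw [cnt_formula' a b k hlt hkb]
  have hnn : (1 - y) * a ≤ (((a - k) + (b - k) : ℕ) : ℝ) := by
    push_cast [Nat.cast_sub hkb, Nat.cast_sub (hkb.trans hlt.le)]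
    linarith
  have c1 : (((a - k) + (b - k)).choose (a - k) : ℝ) ≤
      √2 * 2 ^ ((a - k) + (b - k)) / √((1 - y) * a) := by
    refine (choose_bound_real _ _).trans ?_
    gcongr
    linarith
  have c2 : ((k + k).choose k : ℝ) ≤ √2 * 2 ^ (k + k) / √(u * a) := by
    refine (choose_bound_real _ _).trans ?_
    gcongr
    push_cast
    linarith [k.cast_nonneg (α := ℝ)]
  have c3 : c * 2 ^ (a + b) / √(2 * a) ≤ ((a + b).choose a : ℝ) := by
    rw [choose_eq_gg a b (by omega)]
    have : (0:ℝ) < ((a + b : ℕ) : ℝ) := Nat.cast_pos.2 (by omega)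
    have hgp : 0 < gg a b := hc.trans hg
    gcongr
    push_cast; linarith
  have c4 : (a : ℝ) - b ≤ (ρ + 1) * √(a : ℝ) := by
    rw [div_lt_iff₀ (by positivity)] at hd
    exact hd.le
  have hp : (2:ℝ) ^ (a + b) = 2 ^ (a - k + (b - k)) * 2 ^ (k + k) := by
    rw [← pow_add]; congr 1; omega
  have hd0 : 0 ≤ (a : ℝ) - b := by linarith
  rw [Real.norm_of_nonneg (by rw [hpr]; positivity), hpr]
  calc _ ≤ (a : ℝ) * ((((ρ + 1) * √(a : ℝ)) / ((1 - y) * a)) *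
        (√2 * 2 ^ ((a - k) + (b - k)) / √((1 - y) * a)) * (√2 * 2 ^ (k + k) / √(u * a)) /
        (c * 2 ^ (a + b) / √(2 * a))) := by
        gcongr
    _ = _ := by
        rw [hp, Real.sqrt_mul h1y.le, Real.sqrt_mul hu.le, Real.sqrt_mul (by norm_num) (a : ℝ)]
        have := Real.sqrt_pos.2 hpos
        have := Real.sqrt_pos.2 hu
        have := Real.sqrt_pos.2 h1y
        field_simp

/-- Hitting time and first pure luck guess: if `m₂ ≤ m₁`, `m₁ → ∞` and
`(m₁-m₂)/√m₁ → ρ > 0`, then for every `0 < x < 1`,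
`P(H_{m₁,m₂} ≤ x m₁) → ∫_0^x f_R(u) du`, with `f_R` the density of
`R(ρ²/2)`, the reciprocal of a shifted Lévy variable with parameter
`c = ρ²/2`. -/
theorem stmt17 (m₁ m₂ : ℕ → ℕ) (ρ : ℝ) (hρ : 0 < ρ)
    (hle : ∀ k, m₂ k ≤ m₁ k)
    (hm : Filter.Tendsto (fun k => (m₁ k : ℝ)) Filter.atTop Filter.atTop)
    (hρlim : Filter.Tendsto (fun k => ((m₁ k : ℝ) - (m₂ k : ℝ)) / Real.sqrt (m₁ k))
      Filter.atTop (nhds ρ)) :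
    ∀ x : ℝ, 0 < x → x < 1 →
      Filter.Tendsto (fun k => PHle (m₁ k) (m₂ k) (x * (m₁ k : ℝ))) Filter.atTop
        (nhds (∫ u in (0:ℝ)..x,
          Real.sqrt ((ρ ^ 2 / 2) / (2 * Real.pi)) * (1 - u) ^ (-(3:ℝ)/2) *
            u ^ (-(1:ℝ)/2) * Real.exp (-((ρ ^ 2 / 2) * u) / (2 * (1 - u))))) := by
  intro x hx hx1
  obtain ⟨y, hxy, hy1⟩ := exists_between hx1
  have hy : 0 < y := hx.trans hxy
  obtain ⟨C, hC, hdom⟩ := dom m₁ m₂ ρ hρ hm hρlim y hy hy1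
  set G : ℕ → ℝ → ℝ := fun j u => (m₁ j : ℝ) * pr (m₁ j) (m₂ j) ⌊u * m₁ j⌋₊ with hG
  have hpos := hm.eventually_gt_atTop 0
  have hmeas : ∀ j, Measurable (G j) := by
    intro j
    have h1 : Measurable (fun u : ℝ => ⌊u * (m₁ j : ℝ)⌋₊) :=
      Nat.measurable_floor.comp (measurable_id.mul_const _)
    exact ((measurable_from_top (f := fun k : ℕ => pr (m₁ j) (m₂ j) k)).comp h1).const_mul _
  have main : Tendsto (fun j => ∫ u in (0:ℝ)..x, G j u) atTop
        (𝓝 (∫ u in (0:ℝ)..x,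
          Real.sqrt ((ρ ^ 2 / 2) / (2 * Real.pi)) * (1 - u) ^ (-(3:ℝ)/2) *
            u ^ (-(1:ℝ)/2) * Real.exp (-((ρ ^ 2 / 2) * u) / (2 * (1 - u))))) := by
    apply intervalIntegral.tendsto_integral_filter_of_dominated_convergence
      (bound := fun u => C * u ^ (-(1/2) : ℝ))
    · exact Eventually.of_forall fun j => (hmeas j).aestronglyMeasurable
    · filter_upwards [hdom] with j hj
      refine Eventually.of_forall fun u hu => ?_
      rw [Set.uIoc_of_le hx.le] at hu
      have := hj u hu.1 (hu.2.trans hxy.le)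
      rwa [Real.sqrt_eq_rpow, ← Real.rpow_neg hu.1.le] at this
    · exact (intervalIntegral.intervalIntegrable_rpow' (by norm_num)).const_mul C
    · refine Eventually.of_forall fun u hu => ?_
      rw [Set.uIoc_of_le hx.le] at hu
      exact ptw m₁ m₂ ρ hρ hm hρlim u hu.1 (hu.2.trans_lt hx1)
  have rem : Tendsto (fun j => ∫ u in x..(((⌊x * m₁ j⌋₊ + 1 : ℕ) : ℝ) / m₁ j), G j u) atTop (𝓝 0) := by
    have hz : Tendsto (fun j => (C * (√x)⁻¹) * (m₁ j : ℝ)⁻¹) atTop (𝓝 0) := by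
      have := (tendsto_inv_atTop_zero.comp hm).const_mul (C * (√x)⁻¹)
      simpa using this
    refine squeeze_zero_norm' ?_ hz
    have hsm : ∀ᶠ j in atTop, (m₁ j : ℝ)⁻¹ < y - x :=
      (tendsto_inv_atTop_zero.comp hm).eventually_lt_const (sub_pos.2 hxy)
    filter_upwards [hdom, hpos, hsm] with j hj hp hs
    have hf1 : x ≤ ((⌊x * m₁ j⌋₊ + 1 : ℕ) : ℝ) / m₁ j := by
      rw [le_div_iff₀ hp]; push_cast; exact (Nat.lt_floor_add_one _).le
    have hf2 : ((⌊x * m₁ j⌋₊ + 1 : ℕ) : ℝ) / m₁ j ≤ x + (m₁ j : ℝ)⁻¹ := by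
      rw [div_le_iff₀ hp, add_mul, inv_mul_cancel₀ hp.ne']; push_cast
      have := Nat.floor_le (show 0 ≤ x * (m₁ j : ℝ) by positivity)
      linarith
    refine (intervalIntegral.norm_integral_le_of_norm_le_const (C := C * (√x)⁻¹) ?_).trans ?_
    · intro u hu
      rw [Set.uIoc_of_le hf1] at hu
      refine (hj u (hx.trans hu.1) (by linarith [hu.2])).trans ?_
      have := hu.1.le
      gcongr
    · gcongr
      rw [abs_of_nonneg (by linarith)]
      linarith
  have tot := main.add rem
  rw [add_zero] at tot
  refine tot.congr' ?_
  filter_upwards [hpos] with j hp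
  obtain ⟨i1, i2⟩ := floor_scaled (pr (m₁ j) (m₂ j)) (m₁ j) hp (⌊x * m₁ j⌋₊ + 1)
  have hf1 : x ≤ ((⌊x * m₁ j⌋₊ + 1 : ℕ) : ℝ) / m₁ j := by
    rw [le_div_iff₀ hp]; push_cast; exact (Nat.lt_floor_add_one _).le
  have hmem : x ∈ Set.uIcc (0:ℝ) (((⌊x * m₁ j⌋₊ + 1 : ℕ) : ℝ) / m₁ j) := by
    rw [Set.uIcc_of_le (hx.le.trans hf1)]; exact ⟨hx.le, hf1⟩
  rw [intervalIntegral.integral_add_adjacent_intervals]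
  · rw [PHle_eq _ _ _ (by positivity)]
    exact i2
  · exact i1.mono_set (Set.uIcc_subset_uIcc Set.left_mem_uIcc hmem)
  · exact i1.mono_set (Set.uIcc_subset_uIcc hmem Set.right_mem_uIcc)
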